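/- Let P ⊆ ℕ and for x, y ∈ Σ_P and t > 0 define F_{xy}(t) = liminf_{n→∞} (1/n)|{0 ≤ m ≤ n−1 : d(σᵐx, σᵐy) < t}|. If there exist x, y ∈ Σ_P and t > 0 with F_{xy}(t) < 1, then there exists a point z ∈ Σ_P whose support A_z has positive upper density. -/

import Mathlib

open Filter Topology

/-- The spacing shift `Σ_P ⊆ {0,1}^ℕ` determined by `P ⊆ ℕ`: a `0`-`1` sequence `x`
(encoded as `x : ℕ → Bool`) belongs to `Σ_P` iff whenever two coordinates are `1`,
the (positive) distance between them lies in `P`. -/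
def SpacingShift (P : Set ℕ) : Set (ℕ → Bool) :=
  {x | ∀ i j : ℕ, i < j → x i = true → x j = true → j - i ∈ P}

/-- The left shift map `σ` on sequences. -/
def shift (x : ℕ → Bool) : ℕ → Bool := fun n => x (n + 1)

/-- The support `A_y = {i : y_i = 1}` of a point of the shift space. -/
def supp (x : ℕ → Bool) : Set ℕ := {i | x i = true}

/-- `A ⊆ ℕ` has density `d`, i.e. `|A ∩ {1,…,n}| / n → d`. -/
def HasDensity (A : Set ℕ) (d : ℝ) : Prop :=
  Tendsto (fun n : ℕ => (Nat.card (A ∩ Set.Icc 1 n : Set ℕ) : ℝ) / n) atTop (𝓝 d)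

/-- The upper density `d̄(A) = limsup_n |A ∩ {1,…,n}| / n`. -/
noncomputable def upperDensity (A : Set ℕ) : ℝ :=
  limsup (fun n : ℕ => (Nat.card (A ∩ Set.Icc 1 n : Set ℕ) : ℝ) / n) atTop

/-- The upper Banach density `d*(A)`: the limsup, as the window length tends to infinity,
of the maximal proportion of elements of `A` in a window of that length. -/
noncomputable def upperBanachDensity (A : Set ℕ) : ℝ :=
  limsup (fun n : ℕ =>
    ⨆ m : ℕ, (Nat.card (A ∩ Set.Icc m (m + n) : Set ℕ) : ℝ) / (n + 1)) atTop

/-- `D ⊆ ℕ` is a Δ-set: it contains the difference set `{s_i - s_j : i > j}` of some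
strictly increasing sequence of natural numbers. -/
def IsDeltaSet (D : Set ℕ) : Prop :=
  ∃ s : ℕ → ℕ, StrictMono s ∧ ∀ i j : ℕ, j < i → s i - s j ∈ D

/-- `D ⊆ ℕ` is a Δ*-set: it meets every Δ-set. -/
def IsDeltaStarSet (D : Set ℕ) : Prop :=
  ∀ D' : Set ℕ, IsDeltaSet D' → (D ∩ D').Nonempty

open Classical in
/-- The standard metric on the shift space: `d(x,y) = 2^{-min{n : x_n ≠ y_n}}`,
and `d(x,x) = 0`. -/
noncomputable def seqDist (x y : ℕ → Bool) : ℝ :=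
  if x = y then 0 else (2 : ℝ)⁻¹ ^ sInf {n : ℕ | x n ≠ y n}

/-- The set `FS((a_n))` of finite sums of a sequence of natural numbers:
all sums `a_{i_1} + ⋯ + a_{i_k}` with `i_1 < ⋯ < i_k`. -/
def FSseq (a : ℕ → ℕ) : Set ℕ :=
  {n | ∃ F : Finset ℕ, F.Nonempty ∧ n = ∑ i ∈ F, a i}

/-- `S ⊆ ℕ` is an IP-set: it contains the finite sums of some sequence of positive
natural numbers. -/
def IsIPSet (S : Set ℕ) : Prop :=
  ∃ a : ℕ → ℕ, (∀ n, 0 < a n) ∧ FSseq a ⊆ S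

/-- The set `FS(A)` of finite sums of distinct elements of a set `A ⊆ ℕ`. -/
def FSset (A : Set ℕ) : Set ℕ :=
  {n | ∃ F : Finset ℕ, ↑F ⊆ A ∧ F.Nonempty ∧ n = ∑ i ∈ F, i}

/-- The spacing shift `(Σ_P, σ_P)` is topologically transitive: some point of `Σ_P`
has forward orbit (under the shift) dense in `Σ_P`. -/
def IsTransitiveShift (P : Set ℕ) : Prop :=
  ∃ x ∈ SpacingShift P, SpacingShift P ⊆ closure {y : ℕ → Bool | ∃ n : ℕ, shift^[n] x = y}

/-- `E ⊆ ℕ` is density intersective: it meets the difference set `A - A` of every set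
`A ⊆ ℕ` of positive upper Banach density. -/
def DensityIntersective (E : Set ℕ) : Prop :=
  ∀ A : Set ℕ, 0 < upperBanachDensity A → ∃ a ∈ A, ∃ a' ∈ A, a' < a ∧ a - a' ∈ E

theorem natCard_supp_inter_Icc (x : ℕ → Bool) (n : ℕ) :
    Nat.card (supp x ∩ Set.Icc 1 n : Set ℕ) = ((Finset.Icc 1 n).filter (x · = true)).card := by
  rw [← Set.ncard_coe_finset, ← Nat.card_coe_set_eq]
  congr 2
  ext i
  simp [supp, and_comm]

theorem hasDensity_zero_of_upperDensity_nonpos {A : Set ℕ} (hA : upperDensity A ≤ 0) :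
    HasDensity A 0 := by
  have h0 : ∀ n : ℕ, 0 ≤ (Nat.card (A ∩ Set.Icc 1 n : Set ℕ) : ℝ) / n := fun n => by positivity
  have h1 : ∀ n : ℕ, (Nat.card (A ∩ Set.Icc 1 n : Set ℕ) : ℝ) / n ≤ 1 := fun n => by
    refine div_le_one_of_le₀ ?_ (Nat.cast_nonneg n)
    have := Nat.card_mono (Set.finite_Icc 1 n) (Set.inter_subset_right (s := A))
    have h2 : Nat.card (Set.Icc 1 n) = n := by simp
    exact_mod_cast this.trans h2.le
  have hb : IsBoundedUnder (· ≤ ·) atTop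
      (fun n : ℕ => (Nat.card (A ∩ Set.Icc 1 n : Set ℕ) : ℝ) / n) := isBoundedUnder_of ⟨1, h1⟩
  have hb' : IsBoundedUnder (· ≥ ·) atTop
      (fun n : ℕ => (Nat.card (A ∩ Set.Icc 1 n : Set ℕ) : ℝ) / n) := isBoundedUnder_of ⟨0, h0⟩
  exact tendsto_of_le_liminf_of_limsup_le
    (le_liminf_of_le hb.isCoboundedUnder_ge (Eventually.of_forall h0)) hA hb hb'

theorem iterate_shift_apply (x : ℕ → Bool) (m j : ℕ) : shift^[m] x j = x (m + j) := by
  induction m generalizing j with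
  | zero => simp
  | succ m ih =>
    rw [Function.iterate_succ_apply', shift, ih]
    congr 1
    omega

/-- Points at distance at least `t > 2⁻ᵏ` differ at some coordinate below `k`. -/
theorem exists_ne_of_le_seqDist {u v : ℕ → Bool} {t : ℝ} {k : ℕ} (hk : (2 : ℝ)⁻¹ ^ k < t)
    (ht : t ≤ seqDist u v) : ∃ j < k, u j ≠ v j := by
  by_cases huv : u = v
  · rw [seqDist, if_pos huv] at ht
    have : (0 : ℝ) < 2⁻¹ ^ k := by positivity
    linarith
  · rw [seqDist, if_neg huv] at ht
    refine ⟨sInf {n | u n ≠ v n}, ?_, Nat.sInf_mem (Function.ne_iff.mp huv)⟩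
    exact (pow_lt_pow_iff_right_of_lt_one₀ (by norm_num) (by norm_num)).mp (hk.trans_le ht)

theorem card_filter_add_le (x : ℕ → Bool) (n j : ℕ) :
    ((Finset.range n).filter (fun m => x (m + j) = true)).card ≤
      Nat.card (supp x ∩ Set.Icc 1 n : Set ℕ) + (j + 1) := by
  rw [natCard_supp_inter_Icc, ← Finset.card_map (addRightEmbedding j)]
  calc _ ≤ ((Finset.Icc 1 n).filter (x · = true) ∪ insert 0 (Finset.Ico n (n + j))).card := by
        refine Finset.card_le_card fun i hi => ?_
        simp only [Finset.mem_map, Finset.mem_filter, Finset.mem_range,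
          addRightEmbedding_apply] at hi
        obtain ⟨m, ⟨hm, hxm⟩, rfl⟩ := hi
        simp only [Finset.mem_union, Finset.mem_filter, Finset.mem_Icc, Finset.mem_insert,
          Finset.mem_Ico, hxm, and_true]
        omega
    _ ≤ _ := by
        refine (Finset.card_union_le _ _).trans (Nat.add_le_add_left ?_ _)
        simpa using Finset.card_insert_le 0 (Finset.Ico n (n + j))

open Classical in
theorem card_filter_not_seqDist_lt_le (x y : ℕ → Bool) {t : ℝ} {k : ℕ}
    (hk : (2 : ℝ)⁻¹ ^ k < t) (n : ℕ) :
    ((Finset.range n).filter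
        (fun m => ¬ seqDist (shift^[m] x) (shift^[m] y) < t)).card ≤
      k * (Nat.card (supp x ∩ Set.Icc 1 n : Set ℕ) +
        Nat.card (supp y ∩ Set.Icc 1 n : Set ℕ) + 2 * (k + 1)) := by
  calc _ ≤ ((Finset.range k).biUnion fun j =>
          (Finset.range n).filter (fun m => x (m + j) = true) ∪
            (Finset.range n).filter (fun m => y (m + j) = true)).card := by
        refine Finset.card_le_card fun m hm => ?_
        rw [Finset.mem_filter, not_lt] at hm
        obtain ⟨j, hj, hne⟩ := exists_ne_of_le_seqDist hk hm.2
        rw [iterate_shift_apply, iterate_shift_apply] at hne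
        simp only [Finset.mem_biUnion, Finset.mem_union, Finset.mem_filter]
        refine ⟨j, Finset.mem_range.mpr hj, ?_⟩
        cases hxm : x (m + j) <;> cases hym : y (m + j) <;> simp_all
    _ ≤ (Finset.range k).card * (Nat.card (supp x ∩ Set.Icc 1 n : Set ℕ) +
          Nat.card (supp y ∩ Set.Icc 1 n : Set ℕ) + 2 * (k + 1)) := by
        refine Finset.card_biUnion_le_card_mul _ _ _ fun j hj => ?_
        refine (Finset.card_union_le _ _).trans ?_
        have := card_filter_add_le x n j
        have := card_filter_add_le y n j
        have := Finset.mem_range.mp hj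
        omega
    _ = _ := by rw [Finset.card_range]

open Classical in
theorem tendsto_card_filter_seqDist_lt {x y : ℕ → Bool} (hx : HasDensity (supp x) 0)
    (hy : HasDensity (supp y) 0) {t : ℝ} (ht : 0 < t) :
    Tendsto (fun n : ℕ =>
      (((Finset.range n).filter
        (fun m => seqDist (shift^[m] x) (shift^[m] y) < t)).card : ℝ) / n) atTop (𝓝 1) := by
  obtain ⟨k, hk⟩ := exists_pow_lt_of_lt_one ht (show (2 : ℝ)⁻¹ < 1 by norm_num)
  have hlim : Tendsto (fun n : ℕ => 1 - (k : ℝ) *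
      ((Nat.card (supp x ∩ Set.Icc 1 n : Set ℕ) : ℝ) / n +
        (Nat.card (supp y ∩ Set.Icc 1 n : Set ℕ) : ℝ) / n + 2 * (k + 1) / (n : ℝ)))
      atTop (𝓝 1) := by
    have := (((hx.add hy).add
      (tendsto_const_div_atTop_nhds_zero_nat (2 * ((k : ℝ) + 1)))).const_mul (k : ℝ)).const_sub 1
    simpa using this
  refine tendsto_of_tendsto_of_tendsto_of_le_of_le' hlim tendsto_const_nhds ?_ ?_
  · filter_upwards [eventually_gt_atTop 0] with n hn
    have hn' : (0 : ℝ) < n := Nat.cast_pos.mpr hn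
    have hbad : (_ : ℝ) ≤ _ := Nat.cast_le.mpr (card_filter_not_seqDist_lt_le x y hk n)
    have hsum := Finset.card_filter_add_card_filter_not (s := Finset.range n)
      (fun m => seqDist (shift^[m] x) (shift^[m] y) < t)
    rw [Finset.card_range] at hsum
    have hsum' := congrArg (Nat.cast : ℕ → ℝ) hsum
    push_cast at hbad hsum'
    rw [le_div_iff₀ hn']
    field_simp
    linarith
  · refine Eventually.of_forall fun n => div_le_one_of_le₀ ?_ (Nat.cast_nonneg n)
    exact_mod_cast (Finset.card_filter_le _ _).trans (Finset.card_range n).le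

open Classical in
/-- If `F_{xy}(t) < 1` for some `x, y ∈ Σ_P` and `t > 0`, then some point
of `Σ_P` has support of positive upper density. -/
theorem F_lt_one_implies_pos_upperDensity (P : Set ℕ) (x y : ℕ → Bool)
    (hx : x ∈ SpacingShift P) (hy : y ∈ SpacingShift P) (t : ℝ) (ht : 0 < t)
    (h : liminf (fun n : ℕ =>
        (((Finset.range n).filter
          (fun m => seqDist (shift^[m] x) (shift^[m] y) < t)).card : ℝ) / n) atTop < 1) :
    ∃ z ∈ SpacingShift P, 0 < upperDensity (supp z) := by
  by_contra! hz
  have hlim := tendsto_card_filter_seqDist_lt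
    (hasDensity_zero_of_upperDensity_nonpos (hz x hx))
    (hasDensity_zero_of_upperDensity_nonpos (hz y hy)) ht
  exact h.ne hlim.liminf_eq
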